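/- Let A ∈ ℂ^{n×n} be Hermitian PSD. Then there exists v ∈ ℂⁿ with A ⪰ v v† and e^{n(γ+1)} · per(v v†) ≥ rel(A), where rel(A) = inf{ Π_i D_{ii} : D diagonal, D ⪰ A } and γ is Euler's constant. -/

import Mathlib

open scoped Matrix ComplexOrder

noncomputable def perm {n : ℕ} (M : Matrix (Fin n) (Fin n) ℂ) : ℂ :=
  ∑ σ : Equiv.Perm (Fin n), ∏ i, M i (σ i)

def relSet {n : ℕ} (A : Matrix (Fin n) (Fin n) ℂ) : Set ℝ :=
  {t | ∃ d : Fin n → ℝ,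
    (Matrix.diagonal (fun i => (d i : ℂ)) - A).PosSemidef ∧ ∏ i, d i = t}

section gauss
open MeasureTheory ProbabilityTheory Set

lemma int_log_exp : ∫ t in Ioi (0:ℝ), Real.log t * Real.exp (-t) = -Real.eulerMascheroniConstant := by
  have h1 := Complex.hasDerivAt_GammaIntegral (s := 1) (by simp)
  have h2 : HasDerivAt Complex.Gamma (∫ t : ℝ in Ioi 0, (t:ℂ) ^ ((1:ℂ) - 1) * (Real.log t * Real.exp (-t))) 1 := by
    apply h1.congr_of_eventuallyEq
    have : IsOpen {s : ℂ | 0 < s.re} := isOpen_lt continuous_const Complex.continuous_re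
    filter_upwards [this.mem_nhds (by simp : (1:ℂ) ∈ {s : ℂ | 0 < s.re})] with a ha
    exact Complex.Gamma_eq_integral ha
  have h3 := h2.unique Complex.hasDerivAt_Gamma_one
  simp only [sub_self, Complex.cpow_zero, one_mul] at h3
  have h4 : ∫ t in Ioi (0:ℝ), ((Real.log t * Real.exp (-t) : ℝ) : ℂ) = ((-Real.eulerMascheroniConstant : ℝ) : ℂ) := by
    push_cast
    exact_mod_cast h3
  rw [integral_complex_ofReal] at h4
  exact_mod_cast h4

lemma polar_int (h : ℝ → ℝ) : ∫ w : ℂ, Real.pi⁻¹ * Real.exp (-‖w‖^2) * h (‖w‖^2) = ∫ t in Ioi (0:ℝ), h t * Real.exp (-t) := by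
  have e1 : ∫ w : ℂ, Real.pi⁻¹ * Real.exp (-‖w‖^2) * h (‖w‖^2) =
      ∫ x in Ioi (0 : ℝ) ×ˢ Ioo (-Real.pi) Real.pi, x.1 * (Real.pi⁻¹ * Real.exp (-x.1^2) * h (x.1^2)) * 1 := by
    rw [← Complex.integral_comp_polarCoord_symm, polarCoord_target]
    simp_rw [Complex.norm_polarCoord_symm, smul_eq_mul, sq_abs, mul_one]
  rw [e1, Measure.volume_eq_prod,
    setIntegral_prod_mul (fun x : ℝ => x * (Real.pi⁻¹ * Real.exp (-x^2) * h (x^2))) (fun _ => (1:ℝ))]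
  rw [← integral_comp_rpow_Ioi (fun t => h t * Real.exp (-t)) (two_ne_zero)]
  have : ∫ _ in Ioo (-Real.pi) Real.pi, (1:ℝ) = 2 * Real.pi := by
    simp [Real.pi_pos.le]; ring
  rw [this, ← integral_mul_const]
  refine setIntegral_congr_fun measurableSet_Ioi (fun x hx => ?_)
  have hx' : x ^ ((2:ℝ) - 1) = x := by norm_num
  have hx2 : x ^ (2:ℝ) = x^2 := by norm_cast
  simp only [hx', hx2, smul_eq_mul]
  have := Real.pi_ne_zero
  norm_num
  field_simp

noncomputable def gC : Measure ℂ :=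
  (volume : Measure ℂ).withDensity (fun w => ENNReal.ofReal (Real.pi⁻¹ * Real.exp (-‖w‖^2)))

lemma gC_meas : Measurable (fun w : ℂ => Real.pi⁻¹ * Real.exp (-‖w‖^2)) := by fun_prop

lemma gC_integral {F : Type*} [NormedAddCommGroup F] [NormedSpace ℝ F] (h : ℂ → F) :
    ∫ w, h w ∂gC = ∫ w, (Real.pi⁻¹ * Real.exp (-‖w‖^2)) • h w := by
  rw [gC, integral_withDensity_eq_integral_toReal_smul (by fun_prop) (by simp)]
  congr 1; ext w
  rw [ENNReal.toReal_ofReal (by positivity)]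

lemma gC_charFun (t : ℂ) : charFun gC t = Complex.exp (-‖t‖^2/4) := by
  rw [charFun_apply, gC_integral]
  have := GaussianFourier.integral_cexp_neg_mul_sq_norm_add (V := ℂ) (b := 1) (by simp) Complex.I t
  simp only [Complex.finrank_real_complex] at this
  have e : ∀ x : ℂ, (Real.pi⁻¹ * Real.exp (-‖x‖^2)) • Complex.exp ((inner ℝ x t : ℝ) * Complex.I)
    = (Real.pi:ℂ)⁻¹ * Complex.exp (-1 * ‖x‖ ^ 2 + Complex.I * (inner ℝ t x : ℝ)) := by
    intro x
    rw [Complex.real_smul, Complex.exp_add, real_inner_comm]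
    push_cast
    ring_nf
  simp_rw [e]
  rw [integral_const_mul, this]
  have : (Real.pi:ℂ) ≠ 0 := by exact_mod_cast Real.pi_ne_zero
  norm_num
  try field_simp

instance : IsProbabilityMeasure gC := by
  constructor
  rw [gC, withDensity_apply _ MeasurableSet.univ, Measure.restrict_univ,
    ← ofReal_integral_eq_lintegral_ofReal]
  · have := polar_int (fun _ => 1)
    simp only [mul_one, one_mul, integral_exp_neg_Ioi_zero] at this
    simp [this]
  · apply Integrable.of_integral_ne_zero
    have := polar_int (fun _ => 1)
    simp only [mul_one, one_mul, integral_exp_neg_Ioi_zero] at this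
    simp [this]
  · exact Filter.Eventually.of_forall (fun _ => by positivity)

lemma gC_log : ∫ w, Real.log (‖w‖^2) ∂gC = -Real.eulerMascheroniConstant := by
  rw [gC_integral, ← int_log_exp, ← polar_int]; simp

lemma gC_log_int : Integrable (fun w => Real.log (‖w‖^2)) gC := by
  apply Integrable.of_integral_ne_zero
  rw [gC_log]
  have := Real.one_half_lt_eulerMascheroniConstant
  linarith

lemma gC_sq : ∫ w, ‖w‖^2 ∂gC = 1 := by
  have := Real.Gamma_eq_integral (s := 2) (by norm_num)
  rw [gC_integral]
  have h2 := polar_int (fun t => t)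
  simp only [smul_eq_mul]
  rw [h2]
  norm_num [Real.Gamma_two] at this
  rw [this]
  exact integral_congr_ae (Filter.Eventually.of_forall fun t => mul_comm _ _)

lemma gC_sq_int : Integrable (fun w : ℂ => ‖w‖^2) gC := by
  apply Integrable.of_integral_ne_zero
  rw [gC_sq]; simp

lemma gC_zero : gC {0} = 0 :=
  withDensity_absolutelyContinuous _ _ (by simp)

/-- the scaled linear form -/
noncomputable def linf {m : ℕ} (c : Fin m → ℂ) (z : EuclideanSpace ℂ (Fin m)) : ℂ :=
  ∑ j, c j * ((Real.sqrt 2 : ℝ) : ℂ)⁻¹ * z j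

lemma linf_meas {m : ℕ} (c : Fin m → ℂ) : Measurable (linf c) := by
  unfold linf
  exact Continuous.measurable (by fun_prop)

lemma linf_law {m : ℕ} (c : Fin m → ℂ) (a : ℝ) (ha : a^2 = ∑ j, ‖c j‖^2) :
    (stdGaussian (EuclideanSpace ℂ (Fin m))).map (linf c) = gC.map (fun w => (a:ℂ) * w) := by
  have : IsFiniteMeasure ((stdGaussian (EuclideanSpace ℂ (Fin m))).map (linf c)) := 
    Measure.isFiniteMeasure_map _ _
  have : IsFiniteMeasure (gC.map (fun w => (a:ℂ) * w)) := Measure.isFiniteMeasure_map _ _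
  apply Measure.ext_of_charFun
  ext t
  have h1 : charFun (gC.map (fun w => (a:ℂ) * w)) t = charFun gC ((a:ℂ) * t) := by
    rw [charFun_apply, charFun_apply, integral_map (by fun_prop) (Measurable.aestronglyMeasurable (by fun_prop))]
    congr 1; ext w
    congr 3
    simp [Complex.inner]; ring
  have h2 : charFun ((stdGaussian (EuclideanSpace ℂ (Fin m))).map (linf c)) t =
     charFun (stdGaussian (EuclideanSpace ℂ (Fin m)))
      (WithLp.toLp 2 (fun j => (starRingEnd ℂ) (c j) * ((Real.sqrt 2 : ℝ) : ℂ)⁻¹ * t)) := by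
    rw [charFun_apply, charFun_apply, integral_map (linf_meas c).aemeasurable (Measurable.aestronglyMeasurable (by fun_prop))]
    congr 1; ext z
    congr 3
    simp only [linf, PiLp.inner_apply, Complex.inner, Complex.re_sum, map_sum, map_mul, map_inv₀, Complex.conj_ofReal, Finset.mul_sum]
    refine Finset.sum_congr rfl fun j _ => ?_
    congr 1; ring
  rw [h1, h2, gC_charFun, charFun_stdGaussian]
  congr 1
  rw [← Complex.ofReal_pow, EuclideanSpace.norm_sq_eq]
  simp only [norm_mul, mul_pow, norm_inv, Complex.norm_real, RCLike.norm_conj, Real.norm_eq_abs, abs_of_nonneg (Real.sqrt_nonneg 2), inv_pow, Real.sq_sqrt zero_le_two, Complex.ofReal_mul]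
  rw [← Finset.sum_mul, ← Finset.sum_mul, ← ha]
  push_cast
  rw [← Complex.ofReal_pow |a|, sq_abs]
  push_cast; ring

lemma linf_log {m : ℕ} (c : Fin m → ℂ) (hc : 0 < ∑ j, ‖c j‖^2) :
    Integrable (fun z => Real.log (‖linf c z‖^2)) (stdGaussian (EuclideanSpace ℂ (Fin m))) ∧
    ∫ z, Real.log (‖linf c z‖^2) ∂(stdGaussian (EuclideanSpace ℂ (Fin m))) =
      Real.log (∑ j, ‖c j‖^2) - Real.eulerMascheroniConstant := by
  set a := Real.sqrt (∑ j, ‖c j‖^2) with ha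
  have ha2 : a^2 = ∑ j, ‖c j‖^2 := Real.sq_sqrt hc.le
  have ha0 : 0 < a := Real.sqrt_pos.2 hc
  have law := linf_law c a ha2
  have hm : Measurable (fun w : ℂ => Real.log (‖w‖^2)) := by fun_prop
  have hae : (fun w : ℂ => Real.log (‖(a:ℂ) * w‖^2)) =ᵐ[gC] fun w => Real.log (a^2) + Real.log (‖w‖^2) := by
    have : ∀ᵐ w ∂gC, w ≠ 0 := by
      rw [ae_iff]; simpa using gC_zero
    filter_upwards [this] with w hw
    rw [norm_mul, mul_pow, Real.log_mul]
    · simp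
    · simp [ha0.ne']
    · simpa using hw
  have hi : Integrable (fun w : ℂ => Real.log (‖(a:ℂ) * w‖^2)) gC :=
    (integrable_congr hae).2 ((integrable_const _).add gC_log_int)
  constructor
  · have : Integrable (fun w : ℂ => Real.log (‖w‖^2)) ((stdGaussian (EuclideanSpace ℂ (Fin m))).map (linf c)) := by
      rw [law, integrable_map_measure hm.aestronglyMeasurable (by fun_prop)]
      exact hi
    rw [integrable_map_measure hm.aestronglyMeasurable (linf_meas c).aemeasurable] at this
    exact this
  · rw [← integral_map (φ := linf c) (f := fun w : ℂ => Real.log (‖w‖^2)) (linf_meas c).aemeasurable hm.aestronglyMeasurable, law,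
      integral_map (by fun_prop) hm.aestronglyMeasurable, integral_congr_ae hae,
      integral_add (integrable_const _) gC_log_int, gC_log, ha2]
    simp; ring

lemma linf_null {m : ℕ} (c : Fin m → ℂ) (hc : 0 < ∑ j, ‖c j‖^2) :
    stdGaussian (EuclideanSpace ℂ (Fin m)) {z | linf c z = 0} = 0 := by
  set a := Real.sqrt (∑ j, ‖c j‖^2) with ha
  have ha2 : a^2 = ∑ j, ‖c j‖^2 := Real.sq_sqrt hc.le
  have ha0 : 0 < a := Real.sqrt_pos.2 hc
  have law := linf_law c a ha2
  have h : ((stdGaussian (EuclideanSpace ℂ (Fin m))).map (linf c)) {0} = 0 := by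
    rw [law, Measure.map_apply (by fun_prop) (measurableSet_singleton _)]
    convert gC_zero using 2
    ext w; simp [ha0.ne']
  rw [Measure.map_apply (linf_meas c) (measurableSet_singleton _)] at h
  exact h

lemma linf_sq {m : ℕ} (c : Fin m → ℂ) :
    Integrable (fun z => ‖linf c z‖^2) (stdGaussian (EuclideanSpace ℂ (Fin m))) ∧
    ∫ z, ‖linf c z‖^2 ∂(stdGaussian (EuclideanSpace ℂ (Fin m))) = ∑ j, ‖c j‖^2 := by
  set a := Real.sqrt (∑ j, ‖c j‖^2) with ha
  have ha2 : a^2 = ∑ j, ‖c j‖^2 := Real.sq_sqrt (by positivity)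
  have law := linf_law c a ha2
  have hm : Measurable (fun w : ℂ => ‖w‖^2) := by fun_prop
  have hae : (fun w : ℂ => ‖(a:ℂ) * w‖^2) = fun w => a^2 * ‖w‖^2 := by
    ext w; simp [mul_pow]
  constructor
  · have : Integrable (fun w : ℂ => ‖w‖^2) ((stdGaussian (EuclideanSpace ℂ (Fin m))).map (linf c)) := by
      rw [law, integrable_map_measure hm.aestronglyMeasurable (by fun_prop)]
      change Integrable (fun w : ℂ => ‖(a:ℂ) * w‖^2) gC
      rw [hae]
      exact gC_sq_int.const_mul _
    rw [integrable_map_measure hm.aestronglyMeasurable (linf_meas c).aemeasurable] at this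
    exact this
  · rw [← integral_map (φ := linf c) (f := fun w : ℂ => ‖w‖^2) (linf_meas c).aemeasurable hm.aestronglyMeasurable, law,
      integral_map (by fun_prop) hm.aestronglyMeasurable, hae, integral_const_mul, gC_sq, ha2, mul_one]

lemma gaussian_rounding {n m : ℕ} (C R : Matrix (Fin n) (Fin m) ℂ)
    (hC : ∀ i, 0 < ∑ j, ‖C i j‖^2) :
    ∃ z : Fin m → ℂ, (∀ i, (C *ᵥ z) i ≠ 0) ∧
      ∑ i, (Real.log (∑ j, ‖C i j‖^2) - Real.eulerMascheroniConstant) - ∑ i, ∑ j, ‖R i j‖^2 ≤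
      ∑ i, Real.log (‖(C *ᵥ z) i‖^2) - ∑ i, ‖(R *ᵥ z) i‖^2 := by
  let μ := stdGaussian (EuclideanSpace ℂ (Fin m))
  have hi1 : Integrable (fun z => ∑ i, Real.log (‖linf (C i) z‖^2)) μ :=
    integrable_finsetSum _ fun i _ => (linf_log (C i) (hC i)).1
  have hi2 : Integrable (fun z => ∑ i, ‖linf (R i) z‖^2) μ :=
    integrable_finsetSum _ fun i _ => (linf_sq (R i)).1
  have hN : μ (⋃ i, {z | linf (C i) z = 0}) = 0 :=
    measure_iUnion_null fun i => linf_null (C i) (hC i)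
  obtain ⟨z, hz, hle⟩ := exists_notMem_null_integral_le (hi1.sub hi2) hN
  refine ⟨fun j => ((Real.sqrt 2 : ℝ) : ℂ)⁻¹ * z j, ?_⟩
  have key : ∀ (M : Matrix (Fin n) (Fin m) ℂ) i, (M *ᵥ (fun j => ((Real.sqrt 2 : ℝ) : ℂ)⁻¹ * z j)) i = linf (M i) z := by
    intro M i
    simp [Matrix.mulVec, dotProduct, linf, mul_assoc]
  simp only [key]
  constructor
  · intro i h
    exact hz (mem_iUnion.2 ⟨i, h⟩)
  · simp only [Pi.sub_apply] at hle
    rw [integral_sub hi1 hi2, integral_finsetSum _ (fun i _ => (linf_log (C i) (hC i)).1),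
      integral_finsetSum _ (fun i _ => (linf_sq (R i)).1)] at hle
    simp only [(linf_log (C _) (hC _)).2, (linf_sq (R _)).2] at hle
    linarith

end gauss

section linalg
open Matrix

lemma row_sq {n m : ℕ} (M : Matrix (Fin n) (Fin m) ℂ) (i : Fin n) :
    ((∑ j, ‖M i j‖^2 : ℝ) : ℂ) = (M * Mᴴ) i i := by
  simp [Matrix.mul_apply, Complex.mul_conj, Complex.normSq_eq_norm_sq]

lemma psd_factor {n : ℕ} {A : Matrix (Fin n) (Fin n) ℂ} (hA : A.PosSemidef) :
    ∃ L : Matrix (Fin n) (Fin n) ℂ, A = L * Lᴴ := by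
  open scoped MatrixOrder in
  obtain ⟨B, hB⟩ := CStarAlgebra.nonneg_iff_eq_mul_star_self.1 hA.nonneg
  exact ⟨B, hB⟩

lemma prod_deriv {n : ℕ} (b : Fin n → ℝ) (h : ∀ t : ℝ, 0 < t → t < 1 → ∏ i, (1 + t * b i) ≤ 1) :
    ∑ i, b i ≤ 0 := by
  have hd : HasDerivAt (fun t : ℝ => ∏ i, (1 + t * b i)) (∑ i, b i) 0 := by
    have := HasDerivAt.fun_finsetProd (u := Finset.univ) (f := fun i (t:ℝ) => 1 + t * b i) (f' := b) (x := 0)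
      (fun i _ => by simpa using ((hasDerivAt_id (0:ℝ)).mul_const (b i)).const_add 1)
    simpa using this
  refine le_of_tendsto hd.tendsto_slope_zero_right ?_
  have : ∀ᶠ t : ℝ in nhdsWithin 0 (Set.Ioi 0), t ∈ Set.Ioo (0:ℝ) 1 := Ioo_mem_nhdsGT one_pos
  filter_upwards [this] with t ht
  have := h t ht.1 ht.2
  simp only [zero_add, zero_mul, add_zero, Finset.prod_const_one, smul_eq_mul]
  exact mul_nonpos_of_nonneg_of_nonpos (inv_nonneg.2 ht.1.le) (by linarith)

lemma exists_max {n : ℕ} (L : Matrix (Fin n) (Fin n) ℂ) (hL : ∀ i, 0 < ∑ j, ‖L i j‖^2) :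
    ∃ R : Matrix (Fin n) (Fin n) ℂ, ∑ i, ∑ j, ‖R i j‖^2 = n ∧
      (∀ i, 0 < ∑ j, ‖(L * R) i j‖^2) ∧
      ∀ R' : Matrix (Fin n) (Fin n) ℂ, ∑ i, ∑ j, ‖R' i j‖^2 = n →
        ∏ i, ∑ j, ‖(L * R') i j‖^2 ≤ ∏ i, ∑ j, ‖(L * R) i j‖^2 := by
  let S : Set (Matrix (Fin n) (Fin n) ℂ) := {R | ∑ i, ∑ j, ‖R i j‖^2 = n}
  have hS : IsCompact S := by
    have hb : IsCompact (Metric.closedBall (0 : Fin n → Fin n → ℂ) n) := isCompact_closedBall _ _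
    refine IsCompact.of_isClosed_subset hb ?_ ?_
    · exact isClosed_eq (by fun_prop) continuous_const
    · intro R hR
      change (R : Fin n → Fin n → ℂ) ∈ Metric.closedBall (0 : Fin n → Fin n → ℂ) n
      have hR : ∑ i, ∑ j, ‖R i j‖^2 = n := hR
      refine (mem_closedBall_zero_iff (E := Fin n → Fin n → ℂ)).2 ?_
      refine (pi_norm_le_iff_of_nonneg (Nat.cast_nonneg n)).2 fun i => ?_
      refine (pi_norm_le_iff_of_nonneg (Nat.cast_nonneg n)).2 fun j => ?_
      have h1 : ‖R i j‖^2 ≤ ∑ j, ‖R i j‖^2 :=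
        Finset.single_le_sum (f := fun j => ‖R i j‖^2) (fun _ _ => by positivity) (Finset.mem_univ j)
      have h2 : ∑ j, ‖R i j‖^2 ≤ ∑ i, ∑ j, ‖R i j‖^2 :=
        Finset.single_le_sum (f := fun i => ∑ j, ‖R i j‖^2) (fun _ _ => by positivity) (Finset.mem_univ i)
      have hn : (1:ℝ) ≤ n := by exact_mod_cast Fin.pos i
      refine abs_le_of_sq_le_sq' ?_ (by positivity) |>.2
      nlinarith
  have h1S : (1 : Matrix (Fin n) (Fin n) ℂ) ∈ S := by
    change ∑ i, ∑ j, ‖(1 : Matrix (Fin n) (Fin n) ℂ) i j‖^2 = (n:ℝ)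
    have : ∀ i j, ‖(1 : Matrix (Fin n) (Fin n) ℂ) i j‖^2 = if i = j then 1 else 0 := by
      intro i j
      by_cases h : i = j <;> simp [h, Matrix.one_apply]
    simp [this]
  obtain ⟨R, hR, hmax⟩ := hS.exists_isMaxOn (f := fun R => ∏ i, ∑ j, ‖(L * R) i j‖^2) ⟨1, h1S⟩
    (Continuous.continuousOn (by
      have : Continuous fun R : Matrix (Fin n) (Fin n) ℂ => L * R := by fun_prop
      refine continuous_finsetProd _ fun i _ => continuous_finsetSum _ fun j _ => ?_
      exact ((this.matrix_elem i j).norm.pow 2)))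
  refine ⟨R, hR, ?_, fun R' h => hmax h⟩
  have h1 : ∏ i, ∑ j, ‖(L * (1 : Matrix (Fin n) (Fin n) ℂ)) i j‖^2 ≤ ∏ i, ∑ j, ‖(L * R) i j‖^2 := hmax h1S
  rw [mul_one] at h1
  have h2 : 0 < ∏ i, ∑ j, ‖(L * R) i j‖^2 := lt_of_lt_of_le (Finset.prod_pos fun i _ => hL i) h1
  intro i
  refine lt_of_le_of_ne (by positivity) (fun h => ?_)
  exact h2.ne' (Finset.prod_eq_zero (Finset.mem_univ i) h.symm)

lemma first_order {n : ℕ} (L R : Matrix (Fin n) (Fin n) ℂ) 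
    (hR : ∑ i, ∑ j, ‖R i j‖^2 = n) (hd : ∀ i, 0 < ∑ j, ‖(L * R) i j‖^2)
    (hmax : ∀ R' : Matrix (Fin n) (Fin n) ℂ, ∑ i, ∑ j, ‖R' i j‖^2 = n →
        ∏ i, ∑ j, ‖(L * R') i j‖^2 ≤ ∏ i, ∑ j, ‖(L * R) i j‖^2)
    (u : Fin n → ℂ) (hu : ∑ i, ‖u i‖^2 = n) :
    ∑ i, ‖(L *ᵥ u) i‖^2 / (∑ j, ‖(L * R) i j‖^2) ≤ n := by
  have key := prod_deriv (fun i => ‖(L *ᵥ u) i‖^2 / (∑ j, ‖(L * R) i j‖^2) - 1) ?_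
  · simp at key; linarith
  intro t ht0 ht1
  have hpsd : ((1 - t) • (R * Rᴴ) + t • vecMulVec u (star u)).PosSemidef :=
    ((posSemidef_self_mul_conjTranspose R).smul (by linarith)).add
      ((posSemidef_vecMulVec_self_star u).smul ht0.le)
  obtain ⟨R', hR'⟩ := psd_factor hpsd
  have h1 : ∀ i, ∑ j, ‖R' i j‖^2 = (1-t) * ∑ j, ‖R i j‖^2 + t * ‖u i‖^2 := by
    intro i
    apply Complex.ofReal_injective
    rw [row_sq, ← hR']
    push_cast
    have := row_sq R i
    push_cast at this
    rw [this]
    simp [vecMulVec_apply, Complex.mul_conj, Complex.normSq_eq_norm_sq]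
  have h2 : ∀ i, ∑ j, ‖(L * R') i j‖^2 = (1-t) * ∑ j, ‖(L * R) i j‖^2 + t * ‖(L *ᵥ u) i‖^2 := by
    intro i
    apply Complex.ofReal_injective
    rw [row_sq, conjTranspose_mul, Matrix.mul_assoc, ← Matrix.mul_assoc R', ← hR']
    push_cast
    have := row_sq (L * R) i
    push_cast at this
    rw [this]
    have e : L * (((1 - t) • (R * Rᴴ) + t • vecMulVec u (star u)) * Lᴴ) =
      (1 - t) • (L * R * (L * R)ᴴ) + t • vecMulVec (L *ᵥ u) (star (L *ᵥ u)) := by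
      rw [star_mulVec, ← vecMulVec_mul, ← mul_vecMulVec, conjTranspose_mul]
      simp only [Matrix.add_mul, Matrix.mul_add, Matrix.smul_mul, Matrix.mul_smul, Matrix.mul_assoc]
    rw [e]
    simp [vecMulVec_apply, Complex.mul_conj, Complex.normSq_eq_norm_sq]
  have h3 := hmax R' (by
    simp_rw [h1]
    rw [Finset.sum_add_distrib, ← Finset.mul_sum, ← Finset.mul_sum, hR, hu]; ring)
  have h4 : ∀ i, ∑ j, ‖(L * R') i j‖^2 = (∑ j, ‖(L * R) i j‖^2) * (1 + t * (‖(L *ᵥ u) i‖^2 / (∑ j, ‖(L * R) i j‖^2) - 1)) := by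
    intro i
    rw [h2]
    have := (hd i).ne'
    field_simp
    ring
  simp_rw [h4] at h3
  rw [Finset.prod_mul_distrib] at h3
  have h5 : 0 < ∏ i, ∑ j, ‖(L * R) i j‖^2 := Finset.prod_pos fun i _ => hd i
  exact le_of_mul_le_mul_left (by rwa [mul_one]) h5

lemma first_order' {n : ℕ} (L : Matrix (Fin n) (Fin n) ℂ) (d : Fin n → ℝ)
    (h : ∀ u : Fin n → ℂ, ∑ i, ‖u i‖^2 = n → ∑ i, ‖(L *ᵥ u) i‖^2 / d i ≤ n)
    (y : Fin n → ℂ) : ∑ i, ‖(L *ᵥ y) i‖^2 / d i ≤ ∑ i, ‖y i‖^2 := by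
  rcases (show 0 ≤ ∑ i, ‖y i‖^2 by positivity).eq_or_lt with h0 | h0
  · have hy : y = 0 := by
      ext i
      have := (Finset.sum_eq_zero_iff_of_nonneg (fun i _ => by positivity)).1 h0.symm i (Finset.mem_univ i)
      simpa using this
    simp [hy]
  · have hn : (0:ℝ) < n := by
      rcases Nat.eq_zero_or_pos n with rfl | hn
      · simp at h0
      · exact_mod_cast hn
    set s := ∑ i, ‖y i‖^2 with hs
    set a := Real.sqrt (n / s) with ha
    have ha2 : a^2 = n / s := Real.sq_sqrt (by positivity)
    have e1 := h ((a:ℂ) • y) (by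
      simp only [Pi.smul_apply, smul_eq_mul, norm_mul, mul_pow, Complex.norm_real, Real.norm_eq_abs, sq_abs]
      rw [← Finset.mul_sum, ha2, ← hs]; field_simp)
    rw [mulVec_smul] at e1
    simp only [Pi.smul_apply, smul_eq_mul, norm_mul, mul_pow, Complex.norm_real, Real.norm_eq_abs, sq_abs, mul_div_assoc] at e1
    rw [← Finset.mul_sum, ha2, div_mul_eq_mul_div, div_le_iff₀ h0] at e1
    exact le_of_mul_le_mul_left e1 hn

lemma quad_self {n : ℕ} (L : Matrix (Fin n) (Fin n) ℂ) (w : Fin n → ℂ) :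
    star w ⬝ᵥ ((L * Lᴴ) *ᵥ w) = ((∑ i, ‖(Lᴴ *ᵥ w) i‖^2 : ℝ) : ℂ) := by
  rw [← mulVec_mulVec, dotProduct_mulVec]
  have : star w ᵥ* L = star (Lᴴ *ᵥ w) := by rw [star_mulVec, conjTranspose_conjTranspose]
  rw [this]
  simp [dotProduct, Complex.conj_mul', ]

lemma quad_diag {n : ℕ} (d : Fin n → ℝ) (w : Fin n → ℂ) :
    star w ⬝ᵥ ((Matrix.diagonal (fun i => (d i : ℂ))) *ᵥ w) = ((∑ i, d i * ‖w i‖^2 : ℝ) : ℂ) := by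
  simp only [dotProduct, mulVec_diagonal, Pi.star_apply, RCLike.star_def]
  push_cast
  refine Finset.sum_congr rfl fun i _ => ?_
  rw [← Complex.conj_mul']; ring

lemma quad_vv {n : ℕ} (v w : Fin n → ℂ) :
    star w ⬝ᵥ ((vecMulVec v (star v)) *ᵥ w) = ((‖star v ⬝ᵥ w‖^2 : ℝ) : ℂ) := by
  rw [vecMulVec_mulVec]
  simp only [op_smul_eq_smul, dotProduct_smul, smul_eq_mul]
  have : star w ⬝ᵥ v = star (star v ⬝ᵥ w) := by
    simp [dotProduct, mul_comm]
  rw [this]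
  push_cast
  rw [RCLike.star_def, Complex.mul_conj']

lemma diag_psd {n : ℕ} (L : Matrix (Fin n) (Fin n) ℂ) (d : Fin n → ℝ)
    (h : ∀ w : Fin n → ℂ, ∑ i, ‖(Lᴴ *ᵥ w) i‖^2 ≤ ∑ i, d i * ‖w i‖^2) :
    (Matrix.diagonal (fun i => (d i : ℂ)) - L * Lᴴ).PosSemidef := by
  refine .of_dotProduct_mulVec_nonneg ?_ fun w => ?_
  · refine IsHermitian.sub ?_ (isHermitian_mul_conjTranspose_self L)
    rw [IsHermitian, diagonal_conjTranspose]
    congr 1; ext i; simp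
  · rw [sub_mulVec, dotProduct_sub, quad_self, quad_diag, sub_nonneg]
    exact_mod_cast h w

lemma diag_psd_opt {n : ℕ} (L : Matrix (Fin n) (Fin n) ℂ) (d : Fin n → ℝ) (hd : ∀ i, 0 < d i)
    (h : ∀ y : Fin n → ℂ, ∑ i, ‖(L *ᵥ y) i‖^2 / d i ≤ ∑ i, ‖y i‖^2) :
    (Matrix.diagonal (fun i => (d i : ℂ)) - L * Lᴴ).PosSemidef := by
  apply diag_psd
  intro w
  set y := Lᴴ *ᵥ w with hy
  have e : ∑ i, ‖y i‖^2 ≤ ∑ i, ‖w i‖ * ‖(L *ᵥ y) i‖ := by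
    have q := quad_self L w
    rw [← mulVec_mulVec, ← hy] at q
    have : ∑ i, ‖y i‖^2 = ‖star w ⬝ᵥ (L *ᵥ y)‖ := by
      rw [q, Complex.norm_real, Real.norm_of_nonneg (by positivity)]
    rw [this, dotProduct]
    refine (norm_sum_le _ _).trans (le_of_eq ?_)
    simp
  have e2 : ∑ i, 2 * (‖w i‖ * ‖(L *ᵥ y) i‖) ≤ ∑ i, (d i * ‖w i‖^2 + ‖(L *ᵥ y) i‖^2 / d i) := by
    refine Finset.sum_le_sum fun i _ => ?_
    have hdi := hd i
    rw [← sub_nonneg]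
    have : d i * ‖w i‖^2 + ‖(L *ᵥ y) i‖^2 / d i - 2 * (‖w i‖ * ‖(L *ᵥ y) i‖) = (d i * ‖w i‖ - ‖(L *ᵥ y) i‖)^2 / d i := by
      field_simp; ring
    rw [this]; positivity
  rw [← Finset.mul_sum, Finset.sum_add_distrib] at e2
  linarith [h y]

lemma diag_psd_crude {n : ℕ} (L : Matrix (Fin n) (Fin n) ℂ) :
    (Matrix.diagonal (fun i => ((n * ∑ j, ‖L i j‖^2 : ℝ) : ℂ)) - L * Lᴴ).PosSemidef := by
  apply diag_psd L (fun i => n * ∑ j, ‖L i j‖^2)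
  intro w
  have : ∀ j, ‖(Lᴴ *ᵥ w) j‖^2 ≤ n * ∑ i, ‖L i j‖^2 * ‖w i‖^2 := by
    intro j
    have h1 : ‖(Lᴴ *ᵥ w) j‖ ≤ ∑ i, ‖L i j‖ * ‖w i‖ := by
      rw [mulVec, dotProduct]
      refine (norm_sum_le _ _).trans (le_of_eq ?_)
      simp
    calc _ ≤ (∑ i, ‖L i j‖ * ‖w i‖)^2 := by gcongr
      _ ≤ _ := by
        have := sq_sum_le_card_mul_sum_sq (s := Finset.univ) (f := fun i => ‖L i j‖ * ‖w i‖)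
        simpa [mul_pow] using this
  refine (Finset.sum_le_sum fun j _ => this j).trans (le_of_eq ?_)
  rw [← Finset.mul_sum, Finset.sum_comm, Finset.mul_sum]
  refine Finset.sum_congr rfl fun i _ => ?_
  rw [← Finset.sum_mul, mul_assoc]

lemma sub_vv_psd {n : ℕ} (L : Matrix (Fin n) (Fin n) ℂ) (x : Fin n → ℂ) (hx : ∑ i, ‖x i‖^2 ≤ 1) :
    (L * Lᴴ - vecMulVec (L *ᵥ x) (star (L *ᵥ x))).PosSemidef := by
  refine .of_dotProduct_mulVec_nonneg ?_ fun w => ?_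
  · exact (isHermitian_mul_conjTranspose_self L).sub (posSemidef_vecMulVec_self_star _).1
  · rw [sub_mulVec, dotProduct_sub, quad_self, quad_vv, sub_nonneg]
    have h1 : ‖star (L *ᵥ x) ⬝ᵥ w‖ ≤ ∑ i, ‖x i‖ * ‖(Lᴴ *ᵥ w) i‖ := by
      rw [star_mulVec, ← dotProduct_mulVec, dotProduct]
      refine (norm_sum_le _ _).trans (le_of_eq ?_)
      simp
    have h2 := Finset.sum_mul_sq_le_sq_mul_sq Finset.univ (fun i => ‖x i‖) (fun i => ‖(Lᴴ *ᵥ w) i‖)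
    have h3 : ‖star (L *ᵥ x) ⬝ᵥ w‖^2 ≤ (∑ i, ‖x i‖ * ‖(Lᴴ *ᵥ w) i‖)^2 := by gcongr
    have h4 : 0 ≤ ∑ i, ‖(Lᴴ *ᵥ w) i‖^2 := by positivity
    have : ‖star (L *ᵥ x) ⬝ᵥ w‖^2 ≤ ∑ i, ‖(Lᴴ *ᵥ w) i‖^2 := by nlinarith
    exact_mod_cast this

lemma perm_vv {n : ℕ} (v : Fin n → ℂ) :
    (perm (vecMulVec v (star v))).re = n.factorial * ∏ i, ‖v i‖^2 := by
  have : perm (vecMulVec v (star v)) = ((n.factorial * ∏ i, ‖v i‖^2 : ℝ) : ℂ) := by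
    unfold perm
    have h : ∀ σ : Equiv.Perm (Fin n), ∏ i, vecMulVec v (star v) i (σ i) = ((∏ i, ‖v i‖^2 : ℝ) : ℂ) := by
      intro σ
      simp only [vecMulVec_apply, Finset.prod_mul_distrib]
      rw [Equiv.prod_comp σ (star v), ← Finset.prod_mul_distrib]
      push_cast
      refine Finset.prod_congr rfl fun i _ => ?_
      rw [Pi.star_apply, RCLike.star_def, Complex.mul_conj']
    simp [h, Fintype.card_perm]
  rw [this, Complex.ofReal_re]

lemma relSet_le {n : ℕ} {A : Matrix (Fin n) (Fin n) ℂ} (hA : A.PosSemidef) (d : Fin n → ℝ)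
    (h : (Matrix.diagonal (fun i => (d i : ℂ)) - A).PosSemidef) : sInf (relSet A) ≤ ∏ i, d i := by
  refine csInf_le ⟨0, ?_⟩ ⟨d, h, rfl⟩
  rintro t ⟨e, he, rfl⟩
  refine Finset.prod_nonneg fun i _ => ?_
  have h1 := he.diag_nonneg (i := i)
  have h2 := hA.diag_nonneg (i := i)
  simp only [Matrix.sub_apply, diagonal_apply_eq] at h1
  have h3 := add_nonneg h1 h2
  rw [sub_add_cancel] at h3
  exact_mod_cast h3

end linalg

theorem exists_rank_one_witness (n : ℕ) (A : Matrix (Fin n) (Fin n) ℂ)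
    (hA : A.PosSemidef) :
    ∃ v : Fin n → ℂ, (A - Matrix.vecMulVec v (star v)).PosSemidef ∧
      sInf (relSet A) ≤
        Real.exp (n * (Real.eulerMascheroniConstant + 1)) *
          (perm (Matrix.vecMulVec v (star v))).re := by
  obtain ⟨L, rfl⟩ := psd_factor hA
  by_cases hL : ∀ i, 0 < ∑ j, ‖L i j‖^2
  swap
  · push Not at hL
    obtain ⟨i, hi⟩ := hL
    have hi : ∑ j, ‖L i j‖^2 = 0 := le_antisymm hi (by positivity)
    refine ⟨0, by simpa using hA, ?_⟩
    have h := relSet_le hA _ (diag_psd_crude L)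
    rw [Finset.prod_eq_zero (Finset.mem_univ i) (by simp [hi])] at h
    refine h.trans ?_
    rw [perm_vv]
    positivity
  obtain ⟨R, hR, hd, hmax⟩ := exists_max L hL
  have hrel := relSet_le hA _ (diag_psd_opt L _ hd
    (first_order' L _ (first_order L R hR hd hmax)))
  obtain ⟨z, hz, hle⟩ := gaussian_rounding (L * R) R hd
  rw [hR, ← Matrix.mulVec_mulVec] at hle
  simp only [← Matrix.mulVec_mulVec] at hz
  set x := R *ᵥ z with hx
  set d : Fin n → ℝ := fun i => ∑ j, ‖(L * R) i j‖^2 with hdd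
  set s := ∑ i, ‖x i‖^2 with hs
  have hs1 : s ^ n ≤ n.factorial * Real.exp s := by
    have := Real.pow_div_factorial_le_exp (x := s) (by positivity) n
    rwa [div_le_iff₀' (by positivity)] at this
  -- exponentiated inequality
  have hexp : ∏ i, d i ≤ Real.exp (n * (Real.eulerMascheroniConstant + 1)) *
      (Real.exp (-s) * ∏ i, ‖(L *ᵥ x) i‖^2) := by
    have e1 : ∏ i, d i = Real.exp (∑ i, Real.log (d i)) := by
      rw [Real.exp_sum]
      exact Finset.prod_congr rfl fun i _ => (Real.exp_log (hd i)).symm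
    have e2 : ∏ i, ‖(L *ᵥ x) i‖^2 = Real.exp (∑ i, Real.log (‖(L *ᵥ x) i‖^2)) := by
      rw [Real.exp_sum]
      refine Finset.prod_congr rfl fun i _ => (Real.exp_log ?_).symm
      have := norm_pos_iff.2 (hz i)
      positivity
    rw [e1, e2, ← Real.exp_add, ← Real.exp_add, Real.exp_le_exp]
    simp only [Finset.sum_sub_distrib, Finset.sum_const, Finset.card_univ, Fintype.card_fin, nsmul_eq_mul] at hle
    linarith
  have hs0 : 0 < s ^ n := by
    rcases Nat.eq_zero_or_pos n with rfl | hn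
    · simp
    · refine pow_pos (lt_of_le_of_ne (by positivity) fun h => ?_) n
      have hx0 : x = 0 := by
        ext i
        have := (Finset.sum_eq_zero_iff_of_nonneg (fun i _ => by positivity)).1 h.symm i (Finset.mem_univ i)
        simpa using this
      exact hz ⟨0, hn⟩ (by simp [hx0])
  have hsn : 0 ≤ s := by positivity
  set a := (Real.sqrt s)⁻¹ with ha
  have ha2 : a^2 = s⁻¹ := by rw [ha, inv_pow, Real.sq_sqrt hsn]
  refine ⟨L *ᵥ ((a:ℂ) • x), sub_vv_psd L _ ?_, ?_⟩
  · simp only [Pi.smul_apply, smul_eq_mul, norm_mul, mul_pow, Complex.norm_real, Real.norm_eq_abs, sq_abs]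
    rw [← Finset.mul_sum, ha2, ← hs]
    exact inv_mul_le_one
  · rw [perm_vv, Matrix.mulVec_smul]
    simp only [Pi.smul_apply, smul_eq_mul, norm_mul, mul_pow, Complex.norm_real, Real.norm_eq_abs, sq_abs]
    rw [Finset.prod_mul_distrib, ha2, Finset.prod_const, Finset.card_univ, Fintype.card_fin]
    refine hrel.trans (hexp.trans ?_)
    rw [← mul_assoc (n.factorial : ℝ)]
    gcongr
    rw [Real.exp_neg, inv_pow, ← div_eq_mul_inv, le_div_iff₀ hs0, inv_mul_le_iff₀ (Real.exp_pos _)]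
    linarith
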